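/- arXiv:0709.3016 — 2 statements merged into one kernel-verified Lean document; each statement's English description precedes it below -/
import Mathlib

section
/- If t = min{cf(𝔠), r}, then add(v⁰) = cov(v⁰); i.e. under this hypothesis Halbeisen's conjecture holds. -/
open Set

/-- `A`, `B` form a segment when `A ⊆ B` and `B \ A` is infinite. -/
def IsSeg (A B : Set ℕ) : Prop := A ⊆ B ∧ (B \ A).Infinite

/-- The segment `⟨A,B⟩ = {X ∈ [ω]^ω : A ⊆ X ⊆ B}`. -/
def Seg (A B : Set ℕ) : Set (Set ℕ) := {X | X.Infinite ∧ A ⊆ X ∧ X ⊆ B}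

/-- `X ⊆* Y` : the set `X \ Y` is finite. -/
def AlmostSub (X Y : Set ℕ) : Prop := (X \ Y).Finite

/-- The *-segment `⟨A,B⟩* = {X ∈ [ω]^ω : A ⊆* X ⊆* B}`. -/
def StarSeg (A B : Set ℕ) : Set (Set ℕ) := {X | X.Infinite ∧ AlmostSub A X ∧ AlmostSub X B}

/-- `S` is a v⁰-set: every segment contains a segment disjoint from `S`. -/
def IsVZero (S : Set (Set ℕ)) : Prop :=
  ∀ A B, IsSeg A B → ∃ C D, IsSeg C D ∧ Seg C D ⊆ Seg A B ∧ Seg C D ∩ S = ∅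

/-- `S` is a v-set: every segment contains a segment inside `S` or disjoint from `S`. -/
def IsVSet (S : Set (Set ℕ)) : Prop :=
  ∀ A B, IsSeg A B → ∃ C D, IsSeg C D ∧ Seg C D ⊆ Seg A B ∧
    (Seg C D ⊆ S ∨ Seg C D ∩ S = ∅)

/-- `add(v⁰)`: the additivity number of the ideal of v⁰-sets. -/
noncomputable def addV0 : Cardinal :=
  sInf {c : Cardinal | ∃ F : Set (Set (Set ℕ)),
    (∀ S ∈ F, IsVZero S) ∧ ¬ IsVZero (⋃₀ F) ∧ Cardinal.mk ↥F = c}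

/-- `cov(v⁰)`: the covering number of the ideal of v⁰-sets. -/
noncomputable def covV0 : Cardinal :=
  sInf {c : Cardinal | ∃ F : Set (Set (Set ℕ)),
    (∀ S ∈ F, IsVZero S) ∧ ⋃₀ F = {X : Set ℕ | X.Infinite} ∧ Cardinal.mk ↥F = c}

/-- `X` splits `A`: both `A ∩ X` and `A \ X` are infinite. -/
def Splits (X A : Set ℕ) : Prop := (A ∩ X).Infinite ∧ (A \ X).Infinite

/-- The reaping number `r`: the least cardinality of a family of infinite subsets of `ℕ`
not split by any single set. -/
noncomputable def rNum : Cardinal :=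
  sInf {c : Cardinal | ∃ R : Set (Set ℕ), (∀ A ∈ R, A.Infinite) ∧
    (∀ X : Set ℕ, ∃ A ∈ R, ¬ Splits X A) ∧ Cardinal.mk ↥R = c}

/-- strict almost inclusion `A ⊊* B`. -/
def StrictAlmostSub (A B : Set ℕ) : Prop := AlmostSub A B ∧ ¬ AlmostSub B A

/-- The tower number `t`: the least cardinality of a family of infinite subsets of `ℕ`
well-ordered decreasingly by `⊆*` with no infinite pseudo-intersection. -/
noncomputable def tNum : Cardinal :=
  sInf {c : Cardinal | ∃ T : Set (Set ℕ), (∀ A ∈ T, A.Infinite) ∧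
    IsWellOrder ↥T (fun A B => StrictAlmostSub (B : Set ℕ) (A : Set ℕ)) ∧
    (¬ ∃ X : Set ℕ, X.Infinite ∧ ∀ A ∈ T, AlmostSub X A) ∧ Cardinal.mk ↥T = c}


open Filter

theorem almostSub_iff {X Y : Set ℕ} :
    AlmostSub X Y ↔ ∀ᶠ n in cofinite, n ∈ X → n ∈ Y := by
  rw [AlmostSub, eventually_cofinite]
  simp only [Classical.not_imp]
  rfl

theorem AlmostSub.trans {X Y Z : Set ℕ} (h₁ : AlmostSub X Y) (h₂ : AlmostSub Y Z) :
    AlmostSub X Z := by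
  rw [almostSub_iff] at *
  filter_upwards [h₁, h₂] with n using by tauto

theorem AlmostSub.inter {X Y Z : Set ℕ} (h₁ : AlmostSub X Y) (h₂ : AlmostSub X Z) :
    AlmostSub X (Y ∩ Z) := by
  rw [almostSub_iff] at *
  filter_upwards [h₁, h₂] with n a b c using ⟨a c, b c⟩

theorem AlmostSub.union {X Y Z : Set ℕ} (h₁ : AlmostSub X Z) (h₂ : AlmostSub Y Z) :
    AlmostSub (X ∪ Y) Z := by
  rw [almostSub_iff] at *
  filter_upwards [h₁, h₂] with n a b c using c.elim a b

theorem almostSub_of_subset {X Y : Set ℕ} (h : X ⊆ Y) : AlmostSub X Y :=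
  almostSub_iff.2 (Eventually.of_forall fun _ hn => h hn)

theorem AlmostSub.exists_forall_ge {X Y : Set ℕ} (h : AlmostSub X Y) :
    ∃ n, ∀ m ≥ n, m ∈ X → m ∈ Y := by
  rw [almostSub_iff, Nat.cofinite_eq_atTop] at h
  exact eventually_atTop.1 h

theorem Set.Infinite.of_almostSub {X Y : Set ℕ} (hX : X.Infinite) (h : AlmostSub X Y) :
    Y.Infinite := by
  rw [← frequently_cofinite_mem_iff_infinite] at *
  rw [almostSub_iff] at h
  exact (hX.and_eventually h).mono fun n hn => hn.2 hn.1

/-- A pair of sets forming a segment. -/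
@[ext] structure SegPair where
  /-- the lower set -/
  lo : Set ℕ
  /-- the upper set -/
  hi : Set ℕ
  isSeg : IsSeg lo hi

namespace SegPair

/-- Segments are ordered by inclusion modulo finite sets. -/
instance : Preorder SegPair where
  le I J := AlmostSub J.lo I.lo ∧ AlmostSub I.hi J.hi
  le_refl I := ⟨almostSub_of_subset subset_rfl, almostSub_of_subset subset_rfl⟩
  le_trans _ _ _ h₁ h₂ := ⟨h₂.1.trans h₁.1, h₁.2.trans h₂.2⟩

theorem le_of_subset {I J : SegPair} (h₁ : J.lo ⊆ I.lo) (h₂ : I.hi ⊆ J.hi) : I ≤ J :=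
  ⟨almostSub_of_subset h₁, almostSub_of_subset h₂⟩

/-- The *-segment of a pair. -/
def star (I : SegPair) : Set (Set ℕ) := StarSeg I.lo I.hi

theorem star_mono {I J : SegPair} (h : I ≤ J) : I.star ⊆ J.star :=
  fun _ hX => ⟨hX.1, h.1.trans hX.2.1, hX.2.2.trans h.2⟩

theorem seg_subset_star (I : SegPair) : Seg I.lo I.hi ⊆ I.star :=
  fun _ hX => ⟨hX.1, almostSub_of_subset hX.2.1, almostSub_of_subset hX.2.2⟩

theorem hi_mem_seg (I : SegPair) : I.hi ∈ Seg I.lo I.hi :=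
  ⟨I.isSeg.2.mono sdiff_subset, I.isSeg.1, subset_rfl⟩

/-- Two segments are compatible if they have a common lower bound. -/
def Compat (I J : SegPair) : Prop := ∃ K, K ≤ I ∧ K ≤ J

theorem exists_subset_of_le {I K : SegPair} (h : K ≤ I) :
    ∃ L : SegPair, I.lo ⊆ L.lo ∧ L.hi ⊆ I.hi ∧ L ≤ K := by
  obtain ⟨h₁, h₂⟩ := h
  rw [almostSub_iff] at h₁ h₂
  have hK := I.isSeg.1
  have hK' := K.isSeg.1
  refine ⟨⟨I.lo ∪ K.lo ∩ I.hi, I.lo ∪ K.hi ∩ I.hi, ?_, ?_⟩, subset_union_left,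
    union_subset hK inter_subset_right, ?_, ?_⟩
  · exact union_subset_union_right _ (inter_subset_inter_left _ hK')
  · have := K.isSeg.2
    refine this.of_almostSub (almostSub_iff.2 ?_)
    filter_upwards [h₁, h₂] with n a b
    simp only [Set.mem_sdiff, mem_union, mem_inter_iff]
    tauto
  · rw [almostSub_iff]
    filter_upwards [h₁, h₂] with n a b
    have := @hK' n
    simp only [mem_union, mem_inter_iff]
    tauto
  · rw [almostSub_iff]
    filter_upwards [h₁, h₂] with n a b
    have := @hK' n
    simp only [mem_union, mem_inter_iff]
    tauto

theorem almostSub_of_mem_star_of_not_compat {I J : SegPair} (h : ¬ Compat I J) {x y : Set ℕ}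
    (hxI : x ∈ I.star) (hxJ : x ∈ J.star) (hyI : y ∈ I.star) (hyJ : y ∈ J.star) :
    AlmostSub x y := by
  by_contra hxy
  refine h ⟨⟨x ∩ y, x ∪ y, inter_subset_left.trans subset_union_left, ?_⟩, ⟨?_, ?_⟩, ⟨?_, ?_⟩⟩
  · refine Set.Infinite.mono ?_ (s := x \ y) hxy
    intro n hn
    exact ⟨Or.inl hn.1, fun h => hn.2 h.2⟩
  · exact hxI.2.1.inter hyI.2.1
  · exact hxI.2.2.union hyI.2.2
  · exact hxJ.2.1.inter hyJ.2.1
  · exact hxJ.2.2.union hyJ.2.2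

end SegPair

theorem IsSeg.subset_of_seg_subset {A B C D : Set ℕ} (h : IsSeg C D) (hs : Seg C D ⊆ Seg A B) :
    A ⊆ C ∧ D ⊆ B := by
  have hD : D.Infinite := h.2.mono sdiff_subset
  refine ⟨fun a ha => ?_, (hs (a := D) ⟨hD, h.1, subset_rfl⟩).2.2⟩
  by_contra hc
  have : D \ {a} ∈ Seg C D :=
    ⟨hD.sdiff (finite_singleton a), fun n hn => ⟨h.1 hn, by rintro rfl; exact hc hn⟩, sdiff_subset⟩
  exact ((hs this).2.1 ha).2 rfl

theorem IsVZero.exists_subset {S : Set (Set ℕ)} (hS : IsVZero S) (I : SegPair) :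
    ∃ J : SegPair, I.lo ⊆ J.lo ∧ J.hi ⊆ I.hi ∧ ∀ X ∈ Seg J.lo J.hi, X ∉ S := by
  obtain ⟨C, D, h, h₁, h₂⟩ := hS I.lo I.hi I.isSeg
  obtain ⟨h₃, h₄⟩ := h.subset_of_seg_subset h₁
  exact ⟨⟨C, D, h⟩, h₃, h₄, fun X hX hXS => (h₂ ▸ ⟨hX, hXS⟩ : X ∈ (∅ : Set (Set ℕ)))⟩

theorem isVZero_of_forall_exists_star {S : Set (Set ℕ)}
    (h : ∀ I : SegPair, ∃ J ≤ I, ∀ X ∈ J.star, X ∉ S) : IsVZero S := by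
  intro A B hAB
  obtain ⟨J, hJ, hJS⟩ := h ⟨A, B, hAB⟩
  obtain ⟨L, h₁, h₂, h₃⟩ := SegPair.exists_subset_of_le hJ
  refine ⟨L.lo, L.hi, L.isSeg, fun X hX => ⟨hX.1, h₁.trans hX.2.1, hX.2.2.trans h₂⟩, ?_⟩
  rw [eq_empty_iff_forall_notMem]
  exact fun X hX => hJS X (SegPair.star_mono h₃ (L.seg_subset_star hX.1)) hX.2


/-- A set of segments is open dense if it is downward closed and every segment has a
member of the set below it. -/
def IsOpenDense (D : Set SegPair) : Prop := IsLowerSet D ∧ ∀ I, ∃ J ∈ D, J ≤ I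

namespace SegPair

/-- No infinite set that lies in the segment `I` above `n` belongs to `S`. -/
def AvoidsAbove (S : Set (Set ℕ)) (n : ℕ) (I : SegPair) : Prop :=
  ∀ X : Set ℕ, X.Infinite → (∀ m ≥ n, m ∈ I.lo → m ∈ X) → (∀ m ≥ n, m ∈ X → m ∈ I.hi) → X ∉ S

/-- `J` is a subsegment of `I` that agrees with `I` below `n`. -/
def Freeze (n : ℕ) (J I : SegPair) : Prop :=
  I.lo ⊆ J.lo ∧ J.hi ⊆ I.hi ∧ (∀ m < n, m ∈ J.lo → m ∈ I.lo) ∧ ∀ m < n, m ∈ I.hi → m ∈ J.hi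

theorem exists_freeze_pattern {S : Set (Set ℕ)} (hS : IsVZero S) (I : SegPair) (n : ℕ)
    (p : Finset ℕ) : ∃ J, Freeze n J I ∧ ∀ X : Set ℕ, X.Infinite → (∀ m < n, m ∈ X ↔ m ∈ p) →
      (∀ m ≥ n, m ∈ J.lo → m ∈ X) → (∀ m ≥ n, m ∈ X → m ∈ J.hi) → X ∉ S := by
  have hI := I.isSeg
  have hinf : ∀ {C D : Set ℕ}, (D \ C).Infinite → {m | m ∈ D \ C ∧ n ≤ m}.Infinite := by
    intro C D h
    refine h.of_almostSub (almostSub_iff.2 ?_)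
    rw [Nat.cofinite_eq_atTop]
    filter_upwards [eventually_ge_atTop n] with m hm hm' using ⟨hm', hm⟩
  obtain ⟨K, h₁, h₂, h₃⟩ := hS.exists_subset
    ⟨{m | m < n ∧ m ∈ p ∨ n ≤ m ∧ m ∈ I.lo}, {m | m < n ∧ m ∈ p ∨ n ≤ m ∧ m ∈ I.hi}, by
      refine ⟨fun m hm => hm.imp_right (And.imp_right (@hI.1 m)), (hinf hI.2).mono ?_⟩
      rintro m ⟨⟨h, h'⟩, hm⟩
      exact ⟨Or.inr ⟨hm, h⟩, by rintro (h | h) <;> grind⟩⟩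
  simp only at h₁ h₂
  have hK := K.isSeg
  refine ⟨⟨{m | m < n ∧ m ∈ I.lo ∨ n ≤ m ∧ m ∈ K.lo}, {m | m < n ∧ m ∈ I.hi ∨ n ≤ m ∧ m ∈ K.hi},
    ?_, ?_⟩, ⟨?_, ?_, ?_, ?_⟩, ?_⟩
  · exact fun m hm => hm.imp (And.imp_right (@hI.1 m)) (And.imp_right (@hK.1 m))
  · refine (hinf hK.2).mono ?_
    rintro m ⟨⟨h, h'⟩, hm⟩
    exact ⟨Or.inr ⟨hm, h⟩, by rintro (h | h) <;> grind⟩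
  · intro m hm
    rcases lt_or_ge m n with h | h
    · exact Or.inl ⟨h, hm⟩
    · exact Or.inr ⟨h, h₁ (Or.inr ⟨h, hm⟩)⟩
  · rintro m (⟨h, hm⟩ | ⟨h, hm⟩)
    · exact hm
    · rcases h₂ hm with h' | h' <;> grind
  · rintro m h (hm | hm) <;> grind
  · exact fun m h hm => Or.inl ⟨h, hm⟩
  · intro X hX hp hlo hhi
    refine h₃ X ⟨hX, fun m hm => ?_, fun m hm => ?_⟩
    · rcases lt_or_ge m n with h | h
      · rcases h₂ (hK.1 hm) with h' | h'
        · exact (hp m h).2 h'.2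
        · grind
      · exact hlo m h (Or.inr ⟨h, hm⟩)
    · rcases lt_or_ge m n with h | h
      · exact hK.1 (h₁ (Or.inl ⟨h, (hp m h).1 hm⟩))
      · rcases hhi m h hm with h' | h'
        · grind
        · exact h'.2

theorem Freeze.refl (n : ℕ) (I : SegPair) : Freeze n I I :=
  ⟨subset_rfl, subset_rfl, fun _ _ h => h, fun _ _ h => h⟩

theorem Freeze.trans {n : ℕ} {I J K : SegPair} (h₁ : Freeze n K J) (h₂ : Freeze n J I) :
    Freeze n K I :=
  ⟨h₂.1.trans h₁.1, h₁.2.1.trans h₂.2.1, fun m hm h => h₂.2.2.1 m hm (h₁.2.2.1 m hm h),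
    fun m hm h => h₁.2.2.2 m hm (h₂.2.2.2 m hm h)⟩

theorem exists_freeze {S : Set (Set ℕ)} (hS : IsVZero S) (I : SegPair) (n : ℕ) :
    ∃ J, Freeze n J I ∧ AvoidsAbove S n J := by
  have key : ∀ P : Finset (Finset ℕ), ∃ J, Freeze n J I ∧ ∀ p ∈ P, ∀ X : Set ℕ, X.Infinite →
      (∀ m < n, m ∈ X ↔ m ∈ p) → (∀ m ≥ n, m ∈ J.lo → m ∈ X) →
      (∀ m ≥ n, m ∈ X → m ∈ J.hi) → X ∉ S := by
    intro P
    induction P using Finset.induction_on with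
    | empty => exact ⟨I, Freeze.refl n I, by simp⟩
    | insert p P _ ih =>
      obtain ⟨J, hJ, hJP⟩ := ih
      obtain ⟨K, hK, hKp⟩ := exists_freeze_pattern hS J n p
      refine ⟨K, hK.trans hJ, fun q hq X hX hXq hlo hhi => ?_⟩
      rcases Finset.mem_insert.1 hq with rfl | hq
      · exact hKp X hX hXq hlo hhi
      · exact hJP q hq X hX hXq (fun m hm h => hlo m hm (hK.1 h))
          (fun m hm h => hK.2.1 (hhi m hm h))
  obtain ⟨J, hJ, hJP⟩ := key (Finset.range n).powerset
  refine ⟨J, hJ, fun X hX hlo hhi => ?_⟩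
  classical
  refine hJP ((Finset.range n).filter (· ∈ X)) (by simp) X hX (fun m hm => ?_) hlo hhi
  simp [hm]

theorem exists_star_disjoint {S : Set (Set ℕ)} (hS : IsVZero S) (I : SegPair) :
    ∃ J ≤ I, ∀ X ∈ J.star, X ∉ S := by
  have step : ∀ s : ℕ × SegPair, ∃ t : ℕ × SegPair, s.1 < t.1 ∧ Freeze t.1 t.2 s.2 ∧
      AvoidsAbove S t.1 t.2 ∧ ∃ f, s.1 ≤ f ∧ f < t.1 ∧ f ∈ s.2.hi \ s.2.lo := by
    rintro ⟨n, J⟩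
    obtain ⟨f, hf, hnf⟩ := J.isSeg.2.exists_gt n
    obtain ⟨K, hK, hK'⟩ := exists_freeze hS J (f + 1)
    exact ⟨(f + 1, K), by simp; omega, hK, hK', f, hnf.le, by simp, hf⟩
  choose g hg₁ hg₂ hg₃ hg₄ using step
  let s : ℕ → ℕ × SegPair := fun k => g^[k] (0, I)
  have hs : ∀ k, s (k + 1) = g (s k) := fun k => Function.iterate_succ_apply' g k _
  have hn : StrictMono fun k => (s k).1 := strictMono_nat_of_lt_succ fun k => by
    simp only [hs]; exact hg₁ _
  have hfr : ∀ k d, Freeze (s (k + 1)).1 (s (k + d)).2 (s k).2 := by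
    intro k d
    induction d with
    | zero => exact Freeze.refl _ _
    | succ d ih =>
      refine Freeze.trans (J := (s (k + d)).2) ?_ ih
      have h := hg₂ (s (k + d))
      rw [← hs] at h
      have hle : (s (k + 1)).1 ≤ (s (k + d + 1)).1 := hn.monotone (by omega)
      exact ⟨h.1, h.2.1, fun m hm => h.2.2.1 m (hm.trans_le hle),
        fun m hm => h.2.2.2 m (hm.trans_le hle)⟩
  have hlo : Monotone fun k => (s k).2.lo := by
    intro a b hab
    obtain ⟨d, rfl⟩ := Nat.exists_eq_add_of_le hab
    exact (hfr a d).1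
  have hhi : Antitone fun k => (s k).2.hi := by
    intro a b hab
    obtain ⟨d, rfl⟩ := Nat.exists_eq_add_of_le hab
    exact (hfr a d).2.1
  have hsub : ⋃ k, (s k).2.lo ⊆ ⋂ k, (s k).2.hi := by
    refine iUnion_subset fun a => subset_iInter fun b => ?_
    exact (hlo (le_max_left a b)).trans ((s (max a b)).2.isSeg.1.trans (hhi (le_max_right a b)))
  have hinf : ((⋂ k, (s k).2.hi) \ ⋃ k, (s k).2.lo).Infinite := by
    refine infinite_of_not_bddAbove ?_
    rintro ⟨b, hb⟩
    obtain ⟨f, hf₁, hf₂, hf₃⟩ := hg₄ (s (b + 1))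
    rw [← hs] at hf₂
    have hbf : b + 1 ≤ f := (hn.id_le (b + 1)).trans hf₁
    have : f ∈ (⋂ k, (s k).2.hi) \ ⋃ k, (s k).2.lo := by
      refine ⟨mem_iInter.2 fun k => ?_, fun h => ?_⟩
      · rcases le_total k (b + 1) with h | h
        · exact hhi h hf₃.1
        · obtain ⟨d, rfl⟩ := Nat.exists_eq_add_of_le h
          exact (hfr (b + 1) d).2.2.2 f hf₂ hf₃.1
      · obtain ⟨k, hk⟩ := mem_iUnion.1 h
        rcases le_total k (b + 1) with h | h
        · exact hf₃.2 (hlo h hk)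
        · obtain ⟨d, rfl⟩ := Nat.exists_eq_add_of_le h
          exact hf₃.2 ((hfr (b + 1) d).2.2.1 f hf₂ hk)
    have := hb this
    omega
  refine ⟨⟨_, _, hsub, hinf⟩, le_of_subset (subset_iUnion (fun k => (s k).2.lo) 0)
    (iInter_subset (fun k => (s k).2.hi) 0), fun X hX => ?_⟩
  obtain ⟨n₁, h₁⟩ := hX.2.1.exists_forall_ge
  obtain ⟨n₂, h₂⟩ := hX.2.2.exists_forall_ge
  have hk : n₁ + n₂ + 1 ≤ (s (n₁ + n₂ + 1)).1 := hn.id_le _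
  have havoid := hg₃ (s (n₁ + n₂))
  rw [← hs] at havoid
  exact havoid X hX.1 (fun m hm h => h₁ m (by omega) (mem_iUnion.2 ⟨_, h⟩))
    (fun m hm h => mem_iInter.1 (h₂ m (by omega) h) _)

end SegPair

theorem isVZero_iff_star {S : Set (Set ℕ)} :
    IsVZero S ↔ ∀ I : SegPair, ∃ J ≤ I, ∀ X ∈ J.star, X ∉ S :=
  ⟨SegPair.exists_star_disjoint, isVZero_of_forall_exists_star⟩

theorem IsVZero.isOpenDense {S : Set (Set ℕ)} (hS : IsVZero S) :
    IsOpenDense {I : SegPair | ∀ X ∈ I.star, X ∉ S} := by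
  refine ⟨fun I J h hI X hX => hI X (SegPair.star_mono h hX), fun I => ?_⟩
  obtain ⟨J, h, h'⟩ := SegPair.exists_star_disjoint hS I
  exact ⟨J, h', h⟩


namespace SegPair

/-- A code for the initial segment of `f` below `n`. -/
noncomputable def initCode (f : Set ℕ) (n : ℕ) : ℕ :=
  open Classical in Nat.pair n (Encodable.encode ((Finset.range n).filter (· ∈ f)))

theorem initCode_eq {f g : Set ℕ} {n m : ℕ} (h : initCode f n = initCode g m) :
    n = m ∧ ∀ k < n, k ∈ f ↔ k ∈ g := by
  classical
  obtain ⟨rfl, h₂⟩ := Nat.pair_eq_pair.1 h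
  refine ⟨rfl, fun k hk => ?_⟩
  have := Finset.ext_iff.1 (Encodable.encode_injective h₂) k
  simpa [hk] using this

theorem initCode_injective (f : Set ℕ) : Function.Injective (initCode f) :=
  fun _ _ h => (initCode_eq h).1

theorem not_almostSub_range_initCode {f g : Set ℕ} (hfg : f ≠ g) {e : ℕ → ℕ}
    (he : Function.Injective e) :
    ¬ AlmostSub (range fun n => e (initCode f n)) (range fun n => e (initCode g n)) := by
  obtain ⟨k, hk⟩ : ∃ k, ¬ (k ∈ f ↔ k ∈ g) := by
    by_contra! h
    exact hfg (Set.ext h)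
  refine Set.Infinite.mono (s := (fun n => e (initCode f n)) '' Ioi k) ?_ ?_
  · rintro _ ⟨n, hn, rfl⟩
    refine ⟨⟨n, rfl⟩, ?_⟩
    rintro ⟨m, hm⟩
    exact hk ((initCode_eq (he hm).symm).2 k hn)
  · exact (Ioi_infinite k).image ((he.comp (initCode_injective f)).injOn)

theorem exists_star_disjoint_family (I : SegPair) :
    ∃ K : Set ℕ → SegPair, (∀ f, K f ≤ I) ∧
      ∀ f g X, X ∈ (K f).star → X ∈ (K g).star → f = g := by
  let e := I.isSeg.2.natEmbedding
  have he : Function.Injective fun n => (e n : ℕ) := Subtype.val_injective.comp e.injective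
  let U : Set ℕ → Set ℕ := fun f => range fun n => (e (2 * initCode f n) : ℕ)
  let V : Set ℕ := range fun n => (e (2 * n + 1) : ℕ)
  have hU : ∀ f, U f ⊆ I.hi \ I.lo := by
    rintro f _ ⟨n, rfl⟩
    exact (e _).2
  have hV : V ⊆ I.hi \ I.lo := by
    rintro _ ⟨n, rfl⟩
    exact (e _).2
  have hUV : ∀ f, ∀ m ∈ U f, m ∉ V := by
    rintro f _ ⟨n, rfl⟩ ⟨k, hk⟩
    have := he hk
    omega
  refine ⟨fun f => ⟨I.lo ∪ U f, I.lo ∪ U f ∪ V, subset_union_left, ?_⟩, fun f => ?_, ?_⟩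
  · refine Set.Infinite.mono (s := V) (fun m hm => ⟨Or.inr hm, ?_⟩) ?_
    · rintro (h | h)
      · exact (hV hm).2 h
      · exact hUV f m h hm
    · refine infinite_range_of_injective fun a b hab => ?_
      have := he hab
      omega
  · exact le_of_subset subset_union_left (union_subset (union_subset I.isSeg.1
      fun m hm => (hU f hm).1) fun m hm => (hV hm).1)
  · intro f g X hf hg
    by_contra hfg
    refine not_almostSub_range_initCode hfg (e := fun n => (e (2 * n) : ℕ))
      (fun a b h => by have := he h; omega) (almostSub_iff.2 ?_)
    filter_upwards [almostSub_iff.1 hf.2.1, almostSub_iff.1 hg.2.2] with m h₁ h₂ hm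
    rcases h₂ (h₁ (Or.inr hm)) with (h | h) | h
    · exact absurd h (hU f hm).2
    · exact h
    · exact absurd h (hUV f m hm)

theorem exists_star_avoiding (I : SegPair) {S : Set (Set ℕ)}
    (hS : Cardinal.mk S < Cardinal.continuum) : ∃ K ≤ I, ∀ X ∈ K.star, X ∉ S := by
  obtain ⟨K, hK, hdisj⟩ := exists_star_disjoint_family I
  by_contra! h
  choose x hx hxS using fun f => h (K f) (hK f)
  refine hS.not_ge ?_
  rw [← Cardinal.mk_set_nat]
  refine Cardinal.mk_le_of_injective (f := fun f => (⟨x f, hxS f⟩ : S)) fun f g hfg => ?_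
  have hfg' : x f = x g := congrArg Subtype.val hfg
  exact hdisj f g (x f) (hx f) (hfg' ▸ hx g)

theorem exists_star_disjoint_of_not_compat (I : SegPair) {P : Set SegPair}
    (hP : Cardinal.mk P < Cardinal.continuum) (h : ∀ K ∈ P, ¬ I.Compat K) :
    ∃ L ≤ I, ∀ K ∈ P, ∀ X ∈ L.star, X ∉ K.star := by
  have hx : ∀ K : P, ∃ x, ∀ y ∈ I.star, y ∈ K.1.star → AlmostSub y x ∧ AlmostSub x y := by
    intro K
    by_cases hne : ∃ x, x ∈ I.star ∧ x ∈ K.1.star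
    · obtain ⟨x, hxI, hxK⟩ := hne
      exact ⟨x, fun y hyI hyK =>
        ⟨almostSub_of_mem_star_of_not_compat (h K K.2) hyI hyK hxI hxK,
          almostSub_of_mem_star_of_not_compat (h K K.2) hxI hxK hyI hyK⟩⟩
    · exact ⟨∅, fun y hyI hyK => absurd ⟨y, hyI, hyK⟩ hne⟩
  choose x hx using hx
  obtain ⟨L, hL, hLx⟩ := I.exists_star_avoiding (Cardinal.mk_range_le.trans_lt hP : _ <
    Cardinal.continuum) (S := range x)
  refine ⟨L, hL, fun K hK X hX hXK => ?_⟩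
  obtain ⟨h₁, h₂⟩ := hx ⟨K, hK⟩ X (star_mono hL hX) hXK
  exact hLx _ ⟨hX.1.of_almostSub h₁, hX.2.1.trans h₁, h₂.trans hX.2.2⟩ ⟨⟨K, hK⟩, rfl⟩

theorem mk_le_continuum : Cardinal.mk SegPair ≤ Cardinal.continuum := by
  have h : Cardinal.mk SegPair ≤ Cardinal.mk (Set ℕ × Set ℕ) :=
    Cardinal.mk_le_of_injective (f := fun I : SegPair => (I.lo, I.hi)) fun I J h =>
      SegPair.ext (congrArg Prod.fst h) (congrArg Prod.snd h)
  simpa using h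

instance : Nonempty SegPair := ⟨⟨∅, univ, empty_subset _, by simpa using infinite_univ⟩⟩

end SegPair

theorem isVZero_of_mk_lt_continuum {S : Set (Set ℕ)}
    (hS : Cardinal.mk S < Cardinal.continuum) : IsVZero S :=
  isVZero_iff_star.2 fun I => I.exists_star_avoiding hS

/-- Well-founded recursion with a relational specification. -/
theorem exists_forall_of_wellFounded {ι β : Type*} {r : ι → ι → Prop} (hr : WellFounded r)
    (R : ∀ i, (∀ j, r j i → β) → β → Prop) (hR : ∀ i prev, ∃ v, R i prev v) :
    ∃ f : ι → β, ∀ i, R i (fun j _ => f j) (f i) := by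
  choose g hg using hR
  refine ⟨hr.fix g, fun i => ?_⟩
  rw [hr.fix_eq g i]
  exact hg i _

theorem mk_Iio_ord_toType_lt {c : Cardinal} (i : c.ord.ToType) : Cardinal.mk (Iio i) < c := by
  simpa using Cardinal.mk_Iio_lt i (by simp)

/-- A maximal antichain of segments whose members have pairwise disjoint *-segments. -/
structure IsPartition (D : Set SegPair) : Prop where
  eq_of_mem : ∀ I ∈ D, ∀ J ∈ D, ∀ X, X ∈ I.star → X ∈ J.star → I = J
  exists_compat : ∀ I, ∃ J ∈ D, SegPair.Compat I J

theorem IsOpenDense.exists_isPartition {D : Set SegPair} (hD : IsOpenDense D) :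
    ∃ P ⊆ D, IsPartition P := by
  let ι := (Cardinal.continuum.{0}).ord.ToType
  obtain ⟨enum, henum⟩ : ∃ enum : ι → SegPair, Function.Surjective enum := by
    have h : Cardinal.mk SegPair ≤ Cardinal.mk ι := by
      simpa [ι] using SegPair.mk_le_continuum
    obtain ⟨e⟩ := h
    exact ⟨Function.invFun e, Function.invFun_surjective e.injective⟩
  obtain ⟨J, hJ⟩ := exists_forall_of_wellFounded (ι := ι) (β := Option SegPair)
    (r := (· < ·)) wellFounded_lt
    (fun i prev v => (∃ j h K, prev j h = some K ∧ (enum i).Compat K) ∧ v = none ∨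
      (∀ j h K, prev j h = some K → ¬ (enum i).Compat K) ∧ ∃ L ∈ D, v = some L ∧ L ≤ enum i ∧
        ∀ j h K, prev j h = some K → ∀ X ∈ L.star, X ∉ K.star) (by
    intro i prev
    by_cases hc : ∃ j h K, prev j h = some K ∧ (enum i).Compat K
    · exact ⟨none, Or.inl ⟨hc, rfl⟩⟩
    push Not at hc
    have hcard : Cardinal.mk {K | ∃ j h, prev j h = some K} < Cardinal.continuum := by
      refine (Cardinal.mk_le_mk_of_subset (t := range fun j : Iio i =>
        (prev j j.2).getD (Classical.arbitrary _)) ?_).trans_lt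
        (Cardinal.mk_range_le.trans_lt (mk_Iio_ord_toType_lt i))
      rintro K ⟨j, h, hK⟩
      exact ⟨⟨j, h⟩, by simp [hK]⟩
    obtain ⟨L, hL, hLx⟩ := (enum i).exists_star_disjoint_of_not_compat hcard
      (by rintro K ⟨j, h, hK⟩; exact hc j h K hK)
    obtain ⟨M, hMD, hML⟩ := hD.2 L
    exact ⟨some M, Or.inr ⟨hc, M, hMD, rfl, hML.trans hL, fun j h K hK X hX =>
      hLx K ⟨j, h, hK⟩ X (SegPair.star_mono hML hX)⟩⟩)
  have hdisj : ∀ i j, j < i → ∀ K L, J i = some L → J j = some K → ∀ X ∈ L.star, X ∉ K.star := by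
    intro i j hji K L hL hK
    rcases hJ i with ⟨-, h⟩ | ⟨-, M, -, hM, -, h⟩
    · rw [hL] at h
      cases h
    · rw [hL] at hM
      cases hM
      exact h j hji K hK
  refine ⟨{K | ∃ i, J i = some K}, ?_, ?_, ?_⟩
  · rintro K ⟨i, hi⟩
    rcases hJ i with ⟨-, h⟩ | ⟨-, M, hMD, hM, -⟩
    · rw [hi] at h
      cases h
    · rw [hi] at hM
      cases hM
      exact hMD
  · intro K ⟨i, hi⟩ L ⟨j, hj⟩ X hXK hXL
    rcases lt_trichotomy i j with h | rfl | h
    · exact absurd hXK (hdisj j i h K L hj hi X hXL)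
    · exact Option.some.inj (hi.symm.trans hj)
    · exact absurd hXL (hdisj i j h L K hi hj X hXK)
  · intro I
    obtain ⟨i, rfl⟩ := henum I
    rcases hJ i with ⟨⟨j, _, K, hK, hc⟩, -⟩ | ⟨-, M, _, hM, hMi, -⟩
    · exact ⟨K, ⟨j, hK⟩, hc⟩
    · exact ⟨M, ⟨i, hM⟩, M, hMi, le_rfl⟩


theorem exists_pseudoIntersection {ι : Type} [LinearOrder ι] [WellFoundedLT ι]
    (hι : Cardinal.mk ι < tNum) {E : ι → Set ℕ} (hE : ∀ i, (E i).Infinite)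
    (hdec : ∀ j i, j < i → AlmostSub (E i) (E j)) :
    ∃ X : Set ℕ, X.Infinite ∧ ∀ i, AlmostSub X (E i) := by
  let N : Set ι := {i | ∀ j < i, ¬ AlmostSub (E j) (E i)}
  have hN : ∀ i, ∃ j ∈ N, AlmostSub (E j) (E i) := by
    intro i
    induction i using WellFoundedLT.induction with
    | ind i ih =>
      by_cases hi : i ∈ N
      · exact ⟨i, hi, almostSub_of_subset subset_rfl⟩
      · simp only [N, mem_ofPred_eq, not_forall, not_not] at hi
        obtain ⟨j, hj, hji⟩ := hi
        obtain ⟨k, hk, hkj⟩ := ih j hj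
        exact ⟨k, hk, hkj.trans hji⟩
  have hstrict : ∀ i ∈ N, ∀ j ∈ N, StrictAlmostSub (E j) (E i) ↔ i < j := by
    intro i hi j hj
    refine ⟨fun h => ?_, fun h => ⟨hdec i j h, hj i h⟩⟩
    rcases lt_trichotomy i j with h' | rfl | h'
    · exact h'
    · exact absurd h.1 h.2
    · exact absurd h.1 (hi j h')
  by_contra hcon
  refine hι.not_ge ((csInf_le' ?_ : tNum ≤ Cardinal.mk (E '' N)).trans
    (Cardinal.mk_image_le.trans (Cardinal.mk_set_le N)))
  refine ⟨E '' N, ?_, ?_, ?_, rfl⟩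
  · rintro _ ⟨i, -, rfl⟩
    exact hE i
  · choose idx hidxN hidx using fun A : E '' N => A.2
    have hr : ∀ A B : E '' N, StrictAlmostSub (B : Set ℕ) (A : Set ℕ) ↔ idx A < idx B := by
      intro A B
      rw [← hstrict _ (hidxN A) _ (hidxN B), hidx, hidx]
    have hinj : Function.Injective idx := fun A B h =>
      Subtype.ext ((hidx A).symm.trans ((congrArg E h).trans (hidx B)))
    simp only [hr]
    exact { wf := InvImage.wf idx wellFounded_lt
            trichotomous := fun A B h₁ h₂ => hinj (le_antisymm (not_lt.1 h₂) (not_lt.1 h₁)) }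
  · rintro ⟨X, hX, hXE⟩
    refine hcon ⟨X, hX, fun i => ?_⟩
    obtain ⟨j, hj, hji⟩ := hN i
    exact (hXE _ ⟨j, hj, rfl⟩).trans hji

theorem covV0_le_of_iUnion {ι : Type} (S : ι → Set (Set ℕ)) (hS : ∀ i, IsVZero (S i))
    (hinf : ∀ i, ∀ X ∈ S i, X.Infinite) (hcov : ∀ X : Set ℕ, X.Infinite → ∃ i, X ∈ S i) :
    covV0 ≤ Cardinal.mk ι := by
  refine (csInf_le' ⟨range S, ?_, ?_, rfl⟩ : covV0 ≤ Cardinal.mk (range S)).trans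
    Cardinal.mk_range_le
  · rintro _ ⟨i, rfl⟩
    exact hS i
  · ext X
    simp only [sUnion_range, mem_iUnion, mem_ofPred_eq]
    exact ⟨fun ⟨i, hi⟩ => hinf i X hi, hcov X⟩

theorem covV0_le_cof : covV0 ≤ Cardinal.continuum.ord.cof := by
  let c := (Cardinal.continuum.{0}).ord.ToType
  obtain ⟨s, hs, hsc⟩ := Order.exists_cof_eq c
  have hcof : Order.cof c = Cardinal.continuum.ord.cof := by simp [c]
  rw [← hcof, ← hsc]
  obtain ⟨e⟩ : Nonempty (Set ℕ ≃ c) := by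
    rw [← Cardinal.eq]
    simp [c]
  refine covV0_le_of_iUnion (fun i : s => {X : Set ℕ | X.Infinite ∧ e X ≤ i}) (fun i => ?_)
    (fun i X hX => hX.1) fun X hX => ?_
  · refine isVZero_of_mk_lt_continuum ?_
    have h : Cardinal.mk (Iic (i : c)) < Cardinal.continuum := by
      simpa [c] using Cardinal.mk_Iic_lt (i : c) (by simp [c])
        (by simpa [c] using Cardinal.aleph0_le_continuum)
    refine (Cardinal.mk_le_of_injective (f := fun X => (⟨e X.1, X.2.2⟩ : Iic (i : c))) ?_).trans_lt h
    intro X Y hXY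
    exact Subtype.ext (e.injective (congrArg Subtype.val hXY))
  · obtain ⟨i, hi, hXi⟩ := hs (e X)
    exact ⟨⟨i, hi⟩, hX, hXi⟩

/-- The set of `n` for which `X` has an odd number of elements below `n`. -/
def oddCount (X : Set ℕ) : Set ℕ := {n | Odd (X ∩ Iio n).ncard}

theorem mem_oddCount_iff_notMem {X : Set ℕ} {a b : ℕ} (hab : a ≤ b)
    (h : Odd (X ∩ Ico a b).ncard) : a ∈ oddCount X ↔ b ∉ oddCount X := by
  have hunion : X ∩ Iio b = X ∩ Iio a ∪ X ∩ Ico a b := by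
    rw [← inter_union_distrib_left, Iio_union_Ico_eq_Iio hab]
  have hdisj : Disjoint (X ∩ Iio a) (X ∩ Ico a b) := by
    rw [Set.disjoint_left]
    rintro n ⟨-, h₁⟩ ⟨-, h₂⟩
    exact absurd h₁ (not_lt.2 h₂.1)
  have hcard : (X ∩ Iio b).ncard = (X ∩ Iio a).ncard + (X ∩ Ico a b).ncard := by
    rw [hunion, ncard_union_eq hdisj ((finite_Iio a).inter_of_right _)
      ((finite_Ico a b).inter_of_right _)]
  simp only [oddCount, mem_ofPred_eq, hcard]
  rw [Nat.odd_add]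
  grind

theorem isVZero_not_splits_oddCount {A : Set ℕ} (hA : A.Infinite) :
    IsVZero {X : Set ℕ | X.Infinite ∧ ¬ Splits (oddCount X) A} := by
  rintro C D ⟨hCD, hinf⟩
  have hstep : ∀ n, ∃ a e b f, n ≤ a ∧ a ≤ e ∧ e < b ∧ b ≤ f ∧ a ∈ A ∧ b ∈ A ∧
      e ∈ D \ C ∧ f ∈ D \ C := by
    intro n
    obtain ⟨a, ha, hna⟩ := hA.exists_gt n
    obtain ⟨e, he, hae⟩ := hinf.exists_gt a
    obtain ⟨b, hb, heb⟩ := hA.exists_gt e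
    obtain ⟨f, hf, hbf⟩ := hinf.exists_gt b
    exact ⟨a, e, b, f, hna.le, hae.le, heb, hbf.le, ha, hb, he, hf⟩
  choose a' e' b' f' hstep using hstep
  let s : ℕ → ℕ := fun k => (fun n => f' n + 1)^[k] 0
  have hs : ∀ k, s (k + 1) = f' (s k) + 1 := fun k => Function.iterate_succ_apply' _ k _
  obtain ⟨a, ha⟩ : ∃ a : ℕ → ℕ, ∀ k, a k = a' (s k) := ⟨_, fun _ => rfl⟩
  obtain ⟨b, hb⟩ : ∃ b : ℕ → ℕ, ∀ k, b k = b' (s k) := ⟨_, fun _ => rfl⟩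
  obtain ⟨e, he⟩ : ∃ e : ℕ → ℕ, ∀ k, e k = e' (s k) := ⟨_, fun _ => rfl⟩
  obtain ⟨f, hf⟩ : ∃ f : ℕ → ℕ, ∀ k, f k = f' (s k) := ⟨_, fun _ => rfl⟩
  have hk : ∀ k, s k ≤ a k ∧ a k ≤ e k ∧ e k < b k ∧ b k ≤ f k ∧ f k < s (k + 1) ∧ a k ∈ A ∧
      b k ∈ A ∧ e k ∈ D \ C ∧ f k ∈ D \ C := by
    intro k
    have := hstep (s k)
    rw [← ha, ← hb, ← he, ← hf] at this
    obtain ⟨h₁, h₂, h₃, h₄, h₅⟩ := this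
    exact ⟨h₁, h₂, h₃, h₄, by rw [hs, ← hf]; omega, h₅⟩
  have hmono : StrictMono s := strictMono_nat_of_lt_succ fun k => by have := hk k; omega
  have hlt : ∀ j k, j < k → f j < a k := by
    intro j k hjk
    have h₁ : s (j + 1) ≤ s k := hmono.monotone hjk
    have h₂ := hk j
    have h₃ := hk k
    omega
  clear ha hb he hf
  let C' : Set ℕ := C ∪ {n | ∃ k, n = e k ∧ Even (C ∩ Ico (a k) (b k)).ncard}
  have hfC : ∀ k, f k ∉ C' := by
    rintro k (h | ⟨j, hj, -⟩)
    · exact (hk k).2.2.2.2.2.2.2.2.2 h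
    · have h₁ := hk j
      have h₂ := hk k
      rcases lt_trichotomy j k with h | rfl | h
      · have := hlt j k h
        omega
      · omega
      · have := hlt k j h
        omega
  have hfinj : StrictMono f := strictMono_nat_of_lt_succ fun k => by
    have h₁ := hlt k (k + 1) k.lt_succ_self
    have h₂ := hk (k + 1)
    omega
  have hodd : ∀ X ∈ Seg C' (C' ∪ range f), ∀ k, Odd (X ∩ Ico (a k) (b k)).ncard := by
    rintro X ⟨-, hCX, hXD⟩ k
    have hek := hk k
    have hX : ∀ n ∈ X ∩ Ico (a k) (b k), n ∈ C ∨ n = e k ∧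
        Even (C ∩ Ico (a k) (b k)).ncard := by
      rintro n ⟨hn, hn₁, hn₂⟩
      rcases hXD hn with (h | ⟨j, rfl, hj⟩) | ⟨j, rfl⟩
      · exact Or.inl h
      · have hej := hk j
        rcases lt_trichotomy j k with h | rfl | h
        · have := hlt j k h
          omega
        · exact Or.inr ⟨rfl, hj⟩
        · have := hlt k j h
          omega
      · have hej := hk j
        rcases lt_trichotomy j k with h | rfl | h
        · have := hlt j k h
          omega
        · omega
        · have := hlt k j h
          omega
    rcases Nat.even_or_odd (C ∩ Ico (a k) (b k)).ncard with h | h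
    · have heq : X ∩ Ico (a k) (b k) = insert (e k) (C ∩ Ico (a k) (b k)) := by
        ext n
        constructor
        · intro hn
          rcases hX n hn with h' | h'
          · exact Or.inr ⟨h', hn.2⟩
          · exact Or.inl h'.1
        · rintro (rfl | hn)
          · exact ⟨hCX (Or.inr ⟨k, rfl, h⟩), hek.2.1, hek.2.2.1⟩
          · exact ⟨hCX (Or.inl hn.1), hn.2⟩
      rw [heq, ncard_insert_of_notMem (fun h' => hek.2.2.2.2.2.2.2.1.2 h'.1)
        ((finite_Ico _ _).inter_of_right _)]
      exact h.add_one
    · have heq : X ∩ Ico (a k) (b k) = C ∩ Ico (a k) (b k) := by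
        ext n
        refine ⟨fun hn => ⟨?_, hn.2⟩, fun hn => ⟨hCX (Or.inl hn.1), hn.2⟩⟩
        rcases hX n hn with h' | h'
        · exact h'
        · exact absurd h'.2 (Nat.not_even_iff_odd.2 h)
      rwa [heq]
  refine ⟨C', C' ∪ range f, ⟨subset_union_left, ?_⟩, fun X hX => ⟨hX.1, ?_, ?_⟩, ?_⟩
  · refine (infinite_range_of_injective hfinj.injective).mono ?_
    rintro _ ⟨k, rfl⟩
    exact ⟨Or.inr ⟨k, rfl⟩, hfC k⟩
  · exact subset_union_left.trans hX.2.1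
  · refine hX.2.2.trans ?_
    rintro n ((h | ⟨k, rfl, -⟩) | ⟨k, rfl⟩)
    · exact hCD h
    · exact (hk k).2.2.2.2.2.2.2.1.1
    · exact (hk k).2.2.2.2.2.2.2.2.1
  · rw [eq_empty_iff_forall_notMem]
    rintro X ⟨hX, -, hns⟩
    have halt : ∀ k, a k ∈ oddCount X ↔ b k ∉ oddCount X := fun k =>
      mem_oddCount_iff_notMem (by have := hk k; omega) (hodd X hX k)
    refine hns ⟨infinite_of_forall_exists_gt fun n => ?_,
      infinite_of_forall_exists_gt fun n => ?_⟩
    all_goals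
      have h₁ := hmono.id_le (n + 1)
      have h₂ := hk (n + 1)
      have h₃ := halt (n + 1)
      simp only [id] at h₁
      by_cases h : a (n + 1) ∈ oddCount X
    · exact ⟨_, ⟨h₂.2.2.2.2.2.1, h⟩, by omega⟩
    · exact ⟨_, ⟨h₂.2.2.2.2.2.2.1, by tauto⟩, by omega⟩
    · exact ⟨_, ⟨h₂.2.2.2.2.2.2.1, h₃.1 h⟩, by omega⟩
    · exact ⟨_, ⟨h₂.2.2.2.2.2.1, h⟩, by omega⟩

theorem covV0_le_rNum : covV0 ≤ rNum := by
  refine le_csInf ⟨_, {A : Set ℕ | A.Infinite}, fun A hA => hA, fun X => ?_, rfl⟩ ?_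
  · rcases X.finite_or_infinite with h | h
    · exact ⟨univ, infinite_univ, fun hs => hs.1 (by simpa using h)⟩
    · exact ⟨X, h, fun hs => hs.2 (by simp)⟩
  · rintro _ ⟨R, hR, hsplit, rfl⟩
    refine covV0_le_of_iUnion
      (fun A : R => {X : Set ℕ | X.Infinite ∧ ¬ Splits (oddCount X) A})
      (fun A => isVZero_not_splits_oddCount (hR A A.2)) (fun A X hX => hX.1) fun X hX => ?_
    obtain ⟨A, hA, h⟩ := hsplit (oddCount X)
    exact ⟨⟨A, hA⟩, hX, h⟩

theorem addV0_le_covV0 : addV0 ≤ covV0 := by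
  refine csInf_le_csInf (OrderBot.bddBelow _) ?_ ?_
  · refine ⟨_, (fun X => {X}) '' {X : Set ℕ | X.Infinite}, ?_, by ext; simp, rfl⟩
    rintro _ ⟨X, -, rfl⟩
    refine isVZero_of_mk_lt_continuum ?_
    simpa using Cardinal.one_lt_aleph0.trans Cardinal.aleph0_lt_continuum
  · rintro c ⟨F, hF, hcov, rfl⟩
    refine ⟨F, hF, fun hv => ?_, rfl⟩
    let I : SegPair := Classical.arbitrary _
    obtain ⟨J, -, -, hJ⟩ := hv.exists_subset I
    refine hJ _ J.hi_mem_seg ?_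
    rw [hcov]
    exact J.hi_mem_seg.1

theorem le_addV0 {c : Cardinal} (hc : ∀ F : Set (Set SegPair), (∀ D ∈ F, IsOpenDense D) →
    Cardinal.mk F < c → ∀ I, ∃ J ≤ I, ∀ D ∈ F, J ∈ D) : c ≤ addV0 := by
  have hne : {c : Cardinal | ∃ F : Set (Set (Set ℕ)), (∀ S ∈ F, IsVZero S) ∧
      ¬ IsVZero (⋃₀ F) ∧ Cardinal.mk ↥F = c}.Nonempty := by
    refine ⟨_, (fun X => {X}) '' univ, ?_, ?_, rfl⟩
    · rintro _ ⟨X, -, rfl⟩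
      refine isVZero_of_mk_lt_continuum ?_
      simpa using Cardinal.one_lt_aleph0.trans Cardinal.aleph0_lt_continuum
    · intro hv
      obtain ⟨J, -, -, hJ⟩ := hv.exists_subset (Classical.arbitrary _)
      exact hJ _ J.hi_mem_seg (by simp)
  refine le_csInf hne ?_
  rintro _ ⟨F, hF, hU, rfl⟩
  by_contra! hlt
  refine hU (isVZero_iff_star.2 fun I => ?_)
  obtain ⟨J, hJI, hJ⟩ := hc ((fun S => {I : SegPair | ∀ X ∈ I.star, X ∉ S}) '' F)
    (by rintro _ ⟨S, hS, rfl⟩; exact (hF S hS).isOpenDense)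
    (Cardinal.mk_image_le.trans_lt hlt) I
  refine ⟨J, hJI, ?_⟩
  rintro X hX ⟨S, hS, hXS⟩
  exact hJ _ ⟨S, hS, rfl⟩ X hX hXS


theorem AlmostSub.image {X Y : Set ℕ} (h : AlmostSub X Y) (e : ℕ → ℕ) :
    AlmostSub (e '' X) (e '' Y) :=
  (Set.Finite.image e h).subset <| by
    rintro _ ⟨⟨n, hn, rfl⟩, h⟩
    exact ⟨n, ⟨hn, fun h' => h ⟨n, h', rfl⟩⟩, rfl⟩

theorem AlmostSub.preimage {X Y : Set ℕ} (h : AlmostSub X Y) {e : ℕ → ℕ}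
    (he : Function.Injective e) : AlmostSub (e ⁻¹' X) (e ⁻¹' Y) := by
  have h' : (X \ Y).Finite := h
  exact (h'.preimage he.injOn : (e ⁻¹' (X \ Y)).Finite)

theorem SegPair.exists_dense_embedding (I : SegPair) :
    ∃ φ : SegPair → SegPair, Monotone φ ∧ (∀ J, φ J ≤ I) ∧
      ∀ J K, K ≤ φ J → ∃ L ≤ J, φ L ≤ K := by
  let u := I.isSeg.2.natEmbedding
  let e : ℕ → ℕ := fun n => u n
  have he : Function.Injective e := Subtype.val_injective.comp u.injective
  have heI : ∀ n, e n ∈ I.hi \ I.lo := fun n => (u n).2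
  have hpre : ∀ X, e ⁻¹' (I.lo ∪ e '' X) = X := by
    intro X
    ext n
    simp only [mem_preimage, mem_union, he.mem_set_image]
    exact or_iff_right (heI n).2
  refine ⟨fun J => ⟨I.lo ∪ e '' J.lo, I.lo ∪ e '' J.hi, ?_, ?_⟩, ?_, ?_, ?_⟩
  · exact union_subset_union_right _ (image_mono J.isSeg.1)
  · refine (J.isSeg.2.image he.injOn).mono ?_
    rintro _ ⟨n, hn, rfl⟩
    refine ⟨Or.inr ⟨n, hn.1, rfl⟩, ?_⟩
    rintro (h | h)
    · exact (heI n).2 h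
    · exact hn.2 (he.mem_set_image.1 h)
  · intro J K hJK
    refine ⟨?_, ?_⟩
    · exact (almostSub_of_subset subset_union_left).union
        ((hJK.1.image e).trans (almostSub_of_subset subset_union_right))
    · exact (almostSub_of_subset subset_union_left).union
        ((hJK.2.image e).trans (almostSub_of_subset subset_union_right))
  · refine fun J => le_of_subset subset_union_left (union_subset I.isSeg.1 ?_)
    rintro _ ⟨n, -, rfl⟩
    exact (heI n).1
  · rintro J K ⟨h₁, h₂⟩
    dsimp only at h₁ h₂
    have hIK : AlmostSub I.lo K.lo := (almostSub_of_subset subset_union_left).trans h₁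
    have hKI : AlmostSub K.hi (I.lo ∪ range e) := h₂.trans
      (almostSub_of_subset (union_subset_union_right _ (image_subset_range _ _)))
    refine ⟨⟨e ⁻¹' K.lo, e ⁻¹' K.hi, preimage_mono K.isSeg.1, ?_⟩, ⟨?_, ?_⟩, ⟨?_, ?_⟩⟩
    · have hinf : (e '' (e ⁻¹' (K.hi \ K.lo))).Infinite := by
        refine K.isSeg.2.of_almostSub (almostSub_iff.2 ?_)
        filter_upwards [almostSub_iff.1 hIK, almostSub_iff.1 hKI] with n h₃ h₄ hn
        rcases h₄ hn.1 with h | ⟨m, rfl⟩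
        · exact absurd (h₃ h) hn.2
        · exact ⟨m, hn, rfl⟩
      exact hinf.of_image e
    · simpa only [hpre] using h₁.preimage he
    · simpa only [hpre] using h₂.preimage he
    · rw [almostSub_iff]
      filter_upwards [almostSub_iff.1 hKI] with n h₃ hn
      rcases h₃ (K.isSeg.1 hn) with h | ⟨m, rfl⟩
      · exact Or.inl h
      · exact Or.inr ⟨m, hn, rfl⟩
    · refine (hIK.trans (almostSub_of_subset K.isSeg.1)).union (almostSub_of_subset ?_)
      exact image_preimage_subset _ _

theorem isOpenDense_below {P : Set SegPair} (hP : IsPartition P) :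
    IsOpenDense {I | ∃ K ∈ P, I ≤ K} := by
  refine ⟨fun I J hJI ⟨K, hK, h⟩ => ⟨K, hK, hJI.trans h⟩, fun I => ?_⟩
  obtain ⟨K, hK, L, h₁, h₂⟩ := hP.exists_compat I
  exact ⟨L, ⟨K, hK, h₂⟩, h₁⟩

theorem IsOpenDense.inter {D E : Set SegPair} (hD : IsOpenDense D) (hE : IsOpenDense E) :
    IsOpenDense (D ∩ E) := by
  refine ⟨hD.1.inter hE.1, fun I => ?_⟩
  obtain ⟨J, hJ, hJI⟩ := hD.2 I
  obtain ⟨K, hK, hKJ⟩ := hE.2 J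
  exact ⟨K, ⟨hD.1 hKJ hJ, hK⟩, hKJ.trans hJI⟩

/-- Fewer than `c` open dense sets of segments have an open dense intersection. -/
def IsDistributive (c : Cardinal.{0}) : Prop :=
  ∀ F : Set (Set SegPair), (∀ D ∈ F, IsOpenDense D) → Cardinal.mk F < c →
    IsOpenDense {J | ∀ D ∈ F, J ∈ D}

theorem IsDistributive.exists_refining_partitions {c : Cardinal.{0}} (hc : IsDistributive c)
    {D : c.ord.ToType → Set SegPair} (hD : ∀ i, IsOpenDense (D i)) :
    ∃ P : c.ord.ToType → Set SegPair, (∀ i, IsPartition (P i)) ∧ (∀ i, P i ⊆ D i) ∧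
      ∀ i, ∀ j < i, ∀ I ∈ P i, ∃ K ∈ P j, I ≤ K := by
  obtain ⟨P, hP⟩ := exists_forall_of_wellFounded (ι := c.ord.ToType) (β := Set SegPair)
    (r := (· < ·)) wellFounded_lt
    (fun i prev Q => (∀ j h, IsPartition (prev j h)) → IsPartition Q ∧ Q ⊆ D i ∧
      ∀ j h, ∀ I ∈ Q, ∃ K ∈ prev j h, I ≤ K) (by
    intro i prev
    by_cases hprev : ∀ j h, IsPartition (prev j h)
    · let F : Set (Set SegPair) := range fun j : Iio i => {I | ∃ K ∈ prev j j.2, I ≤ K}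
      have hF := hc F (by rintro _ ⟨j, rfl⟩; exact isOpenDense_below (hprev j j.2))
        (Cardinal.mk_range_le.trans_lt (mk_Iio_ord_toType_lt i))
      obtain ⟨Q, hQ, hQP⟩ := ((hD i).inter hF).exists_isPartition
      exact ⟨Q, fun _ => ⟨hQP, fun I hI => (hQ hI).1, fun j h I hI =>
        (hQ hI).2 _ ⟨⟨j, h⟩, rfl⟩⟩⟩
    · exact ⟨∅, fun h => absurd h hprev⟩)
  have hpart : ∀ i, IsPartition (P i) := by
    intro i
    induction i using WellFoundedLT.induction with
    | ind i ih => exact (hP i ih).1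
  exact ⟨P, hpart, fun i => (hP i fun j _ => hpart j).2.1,
    fun i => (hP i fun j _ => hpart j).2.2⟩

theorem covV0_le_of_iInter_eq_empty {c : Cardinal.{0}} (hc : IsDistributive c) (hct : c < tNum)
    {D : c.ord.ToType → Set SegPair} (hD : ∀ i, IsOpenDense (D i)) (hDe : ⋂ i, D i = ∅) :
    covV0 ≤ c := by
  obtain ⟨P, hP, hPD, href⟩ := hc.exists_refining_partitions hD
  rw [← Cardinal.mk_ord_toType c]
  refine covV0_le_of_iUnion (fun i => {X : Set ℕ | X.Infinite ∧ ∀ J ∈ P i, X ∉ J.star})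
    (fun i => isVZero_iff_star.2 fun I => ?_) (fun i X hX => hX.1) fun X hX => ?_
  · obtain ⟨J, hJ, K, hKI, hKJ⟩ := (hP i).exists_compat I
    exact ⟨K, hKI, fun X hX h => h.2 J hJ (SegPair.star_mono hKJ hX)⟩
  · by_contra! hcon
    have hbranch : ∀ i, ∃ J ∈ P i, X ∈ J.star := by
      intro i
      by_contra! h
      exact hcon i ⟨hX, h⟩
    choose J hJP hJX using hbranch
    have hJ : ∀ j i, j < i → J i ≤ J j := by
      intro j i hji
      obtain ⟨K, hK, hJK⟩ := href i j hji _ (hJP i)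
      rwa [(hP j).eq_of_mem K hK _ (hJP j) X (SegPair.star_mono hJK (hJX i)) (hJX j)] at hJK
    obtain ⟨E, hE, hEJ⟩ := exists_pseudoIntersection (ι := c.ord.ToType) (by simpa using hct)
      (E := fun i => (J i).hi \ (J i).lo) (fun i => (J i).isSeg.2) (by
        intro j i hji
        rw [almostSub_iff]
        filter_upwards [almostSub_iff.1 (hJ j i hji).1, almostSub_iff.1 (hJ j i hji).2]
          with n h₁ h₂ hn using ⟨h₂ hn.1, fun h => hn.2 (h₁ h)⟩)
    let L : SegPair := ⟨X \ E, X ∪ E, sdiff_subset.trans subset_union_left,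
      hE.mono fun n hn => ⟨Or.inr hn, fun h => h.2 hn⟩⟩
    have hL : L ∈ ⋂ i, D i := by
      refine mem_iInter.2 fun i => (hD i).1 (show _ ≤ J i from ⟨?_, ?_⟩) (hPD i (hJP i))
      · rw [almostSub_iff]
        filter_upwards [almostSub_iff.1 (hEJ i), almostSub_iff.1 (hJX i).2.1] with n h₁ h₂ hn
          using ⟨h₂ hn, fun h => (h₁ h).2 hn⟩
      · exact (hJX i).2.2.union ((hEJ i).trans (almostSub_of_subset sdiff_subset))
    rw [hDe] at hL
    exact hL

theorem IsDistributive.le_addV0 {c : Cardinal.{0}} (hc : IsDistributive c) : c ≤ addV0 :=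
  _root_.le_addV0 fun F hF hFc I => by
    obtain ⟨J, hJ, hJI⟩ := (hc F hF hFc).2 I
    exact ⟨J, hJI, hJ⟩

theorem covV0_le_addV0_of_not_isDistributive (h : ¬ IsDistributive tNum) : covV0 ≤ addV0 := by
  let s : Set Cardinal.{0} := {c | ∃ F : Set (Set SegPair), (∀ D ∈ F, IsOpenDense D) ∧
    ¬ IsOpenDense {J | ∀ D ∈ F, J ∈ D} ∧ Cardinal.mk F = c}
  simp only [IsDistributive, not_forall] at h
  obtain ⟨F₀, hF₀, hF₀t, hF₀n⟩ := h
  have hs₀ : Cardinal.mk F₀ ∈ s := ⟨F₀, hF₀, hF₀n, rfl⟩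
  obtain ⟨F, hF, hFn, hFc⟩ := csInf_mem ⟨_, hs₀⟩
  have hct : sInf s < tNum := (csInf_le' hs₀).trans_lt hF₀t
  have hdist : IsDistributive (sInf s) := fun G hG hGc => by
    by_contra hGn
    exact hGc.not_ge (csInf_le' ⟨G, hG, hGn, rfl⟩)
  refine le_trans ?_ hdist.le_addV0
  obtain ⟨u⟩ : Nonempty ((sInf s).ord.ToType ≃ F) := by
    rw [← Cardinal.eq, hFc, Cardinal.mk_ord_toType]
  have hI : ∃ I : SegPair, ∀ J ≤ I, ∃ D ∈ F, J ∉ D := by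
    by_contra! hcon
    refine hFn ⟨fun J K hKJ hJ D hD => (hF D hD).1 hKJ (hJ D hD), fun I => ?_⟩
    obtain ⟨J, hJI, hJ⟩ := hcon I
    exact ⟨J, hJ, hJI⟩
  obtain ⟨I, hI⟩ := hI
  obtain ⟨φ, hφ, hφI, hφd⟩ := I.exists_dense_embedding
  refine covV0_le_of_iInter_eq_empty hdist hct (D := fun i => φ ⁻¹' (u i).1) (fun i => ?_) ?_
  · have hD := hF _ (u i).2
    refine ⟨fun J K hKJ hJ => hD.1 (hφ hKJ) hJ, fun J => ?_⟩
    obtain ⟨K, hK, hKJ⟩ := hD.2 (φ J)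
    obtain ⟨L, hLJ, hLK⟩ := hφd J K hKJ
    exact ⟨L, hD.1 hLK hK, hLJ⟩
  · rw [eq_empty_iff_forall_notMem]
    intro J hJ
    obtain ⟨D, hD, hJD⟩ := hI (φ J) (hφI J)
    refine hJD ?_
    simpa using mem_iInter.1 hJ (u.symm ⟨D, hD⟩)


/-- Halbeisen's conjecture holds under `t = min (cf 𝔠) r`. -/
theorem addV0_eq_covV0_of_tNum_eq_min
    (h : tNum = min Cardinal.continuum.ord.cof rNum) : addV0 = covV0 := by
  refine le_antisymm addV0_le_covV0 ?_
  by_cases ht : IsDistributive tNum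
  · exact (le_min covV0_le_cof covV0_le_rNum).trans (h ▸ ht.le_addV0)
  · exact covV0_le_addV0_of_not_isDistributive ht
end

section
/- Every analytic subset of [ω]^ω is a v-set, where [ω]^ω is viewed as a subspace of the Cantor space 2^ℕ by identifying each infinite subset of ℕ with its characteristic function. -/
open Set

open Classical in
/-- The characteristic function of a subset of `ℕ`, as a point of the Cantor space. -/
noncomputable def chi (X : Set ℕ) : ℕ → Bool := fun n => decide (n ∈ X)

/-- The topology on `[ω]^ω` induced from the Cantor space `2^ℕ` via characteristic
functions. -/
noncomputable def cantorSubspaceTop : TopologicalSpace {X : Set ℕ // X.Infinite} :=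
  TopologicalSpace.induced (fun X => chi X.1) inferInstance

open Filter Topology

/-- The image under `f` of the sequences whose restriction (in reverse order) is `s`. -/
def resImage {X : Type*} (f : (ℕ → ℕ) → X) (s : List ℕ) : Set X :=
  f '' {x | PiNat.res x s.length = s}

theorem resImage_subset_iUnion {X : Type*} (f : (ℕ → ℕ) → X) (s : List ℕ) :
    resImage f s ⊆ ⋃ n, resImage f (n :: s) := by
  rintro _ ⟨x, hx, rfl⟩
  refine mem_iUnion.2 ⟨x s.length, x, ?_, rfl⟩
  simp only [mem_ofPred_eq, List.length_cons, PiNat.res_succ] at hx ⊢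
  rw [hx]

section EssentialClosure

variable {X : Type*} [TopologicalSpace X]

/-- The points in every neighbourhood of which `A` is non-meagre. -/
def essentialClosure (A : Set X) : Set X :=
  {x | ∀ U, IsOpen U → x ∈ U → ¬ IsMeagre (A ∩ U)}

theorem disjoint_essentialClosure_of_isMeagre_inter {A U : Set X} (hU : IsOpen U)
    (h : IsMeagre (A ∩ U)) : Disjoint U (essentialClosure A) :=
  Set.disjoint_left.2 fun _ hxU hx => hx U hU hxU h

theorem isClosed_essentialClosure (A : Set X) : IsClosed (essentialClosure A) := by
  rw [← isOpen_compl_iff, isOpen_iff_forall_mem_open]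
  intro x hx
  simp only [essentialClosure, mem_compl_iff, mem_ofPred_eq, not_forall, not_not] at hx
  obtain ⟨U, hU, hxU, h⟩ := hx
  exact ⟨U, (disjoint_essentialClosure_of_isMeagre_inter hU h).subset_compl_right, hU, hxU⟩

theorem essentialClosure_subset_closure (A : Set X) : essentialClosure A ⊆ closure A := by
  intro x hx
  rw [mem_closure_iff]
  intro U hU hxU
  rw [inter_comm]
  exact nonempty_of_not_isMeagre (hx U hU hxU)

theorem isMeagre_diff_essentialClosure [SecondCountableTopology X] (A : Set X) :
    IsMeagre (A \ essentialClosure A) := by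
  obtain ⟨b, hbc, -, hb⟩ := TopologicalSpace.exists_countable_basis X
  have hc : {U ∈ b | IsMeagre (A ∩ U)}.Countable := hbc.mono (sep_subset _ _)
  refine (isMeagre_biUnion hc (f := fun U => A ∩ U) fun U hU => hU.2).mono ?_
  rintro x ⟨hxA, hx⟩
  simp only [essentialClosure, mem_ofPred_eq, not_forall, not_not] at hx
  obtain ⟨U, hU, hxU, h⟩ := hx
  obtain ⟨V, hV, hxV, hVU⟩ := hb.exists_subset_of_mem_open hxU hU
  exact mem_biUnion (show V ∈ {U ∈ b | IsMeagre (A ∩ U)} from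
    ⟨hV, h.mono (inter_subset_inter_right A hVU)⟩) ⟨hxA, hxV⟩

theorem isMeagre_frontier_of_isClosed {F : Set X} (hF : IsClosed F) : IsMeagre (frontier F) :=
  IsNowhereDense.isMeagre <| by
    rw [IsNowhereDense, isClosed_frontier.closure_eq, interior_frontier hF]

/-- If `A` is covered by the sets `P n`, then the essential closures of the `P n` cover the one
of `A` up to a meagre set. -/
theorem isMeagre_essentialClosure_diff_iUnion [SecondCountableTopology X] {ι : Type*}
    [Countable ι] {A : Set X} {P : ι → Set X} (hA : A ⊆ ⋃ n, P n) :
    IsMeagre (essentialClosure A \ ⋃ n, essentialClosure (P n)) := by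
  set F : Set X := essentialClosure A \ ⋃ n, interior (essentialClosure (P n)) with hFdef
  have hF : IsClosed F :=
    (isClosed_essentialClosure A).sdiff (isOpen_iUnion fun _ => isOpen_interior)
  have hint : interior F = ∅ := by
    have hmeagre : IsMeagre (A ∩ interior F) := by
      refine ((isMeagre_iUnion fun n => isMeagre_diff_essentialClosure (P n)).union
        (isMeagre_iUnion fun n =>
          isMeagre_frontier_of_isClosed (isClosed_essentialClosure (P n)))).mono ?_
      rintro x ⟨hxA, hxF⟩
      obtain ⟨n, hn⟩ := mem_iUnion.1 (hA hxA)
      by_cases hx : x ∈ essentialClosure (P n)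
      · refine Or.inr (mem_iUnion.2 ⟨n, ?_⟩)
        rw [(isClosed_essentialClosure (P n)).frontier_eq]
        exact ⟨hx, fun h => (interior_subset hxF).2 (mem_iUnion.2 ⟨n, h⟩)⟩
      · exact Or.inl (mem_iUnion.2 ⟨n, hn, hx⟩)
    exact eq_empty_of_forall_notMem fun x hx =>
      (interior_subset hx).1 _ isOpen_interior hx hmeagre
  refine (IsNowhereDense.isMeagre (hF.isNowhereDense_iff.2 hint)).mono ?_
  exact sdiff_subset_sdiff_right (iUnion_mono fun n => interior_subset)

theorem eq_of_forall_mem_closure_resImage [T2Space X] {f : (ℕ → ℕ) → X} (hf : Continuous f)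
    {σ : ℕ → ℕ} {x : X} (h : ∀ k, x ∈ closure (resImage f (PiNat.res σ k))) : f σ = x := by
  by_contra hne
  obtain ⟨U, V, hU, hV, hσU, hxV, hUV⟩ := t2_separation hne
  obtain ⟨_, ⟨y, n, rfl⟩, hσ, hsub⟩ :=
    (PiNat.isTopologicalBasis_cylinders (fun _ : ℕ => ℕ)).exists_subset_of_mem_open
      (show σ ∈ f ⁻¹' U from hσU) (hU.preimage hf)
  obtain ⟨_, hzV, τ, hτ, rfl⟩ := mem_closure_iff.1 (h n) V hV hxV
  refine Set.disjoint_left.1 hUV (hsub ?_) hzV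
  rw [← PiNat.mem_cylinder_iff_eq.1 hσ, PiNat.cylinder_eq_res]
  simpa using hτ

/-- Analytic sets have the property of Baire: they are closed up to a meagre set. -/
theorem MeasureTheory.AnalyticSet.isMeagre_essentialClosure_diff [SecondCountableTopology X]
    [T2Space X] {S : Set X} (hS : AnalyticSet S) : IsMeagre (essentialClosure S \ S) := by
  rw [AnalyticSet] at hS
  rcases hS with rfl | ⟨f, hf, rfl⟩
  · refine IsMeagre.empty.mono ?_
    have := essentialClosure_subset_closure (∅ : Set X)
    rw [closure_empty] at this
    exact sdiff_subset.trans this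
  refine (isMeagre_iUnion fun s =>
    isMeagre_essentialClosure_diff_iUnion (resImage_subset_iUnion f s)).mono ?_
  rintro x ⟨hx, hxf⟩
  by_contra hcon
  have hstep : ∀ s, ∃ n, x ∈ essentialClosure (resImage f s) →
      x ∈ essentialClosure (resImage f (n :: s)) := by
    intro s
    by_cases hs : x ∈ essentialClosure (resImage f s)
    · by_contra! hn
      exact hcon (mem_iUnion.2 ⟨s, hs, by simpa using fun n => (hn n).2⟩)
    · exact ⟨0, fun h => absurd h hs⟩
  choose next hnext using hstep
  let L : ℕ → List ℕ := fun k => Nat.rec [] (fun _ s => next s :: s) k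
  have hL : ∀ k, PiNat.res (fun k => next (L k)) k = L k := by
    intro k
    induction k with
    | zero => rfl
    | succ k ih => rw [PiNat.res_succ, ih]
  have hxL : ∀ k, x ∈ essentialClosure (resImage f (L k)) := by
    intro k
    induction k with
    | zero => simpa [L, resImage, image_univ] using hx
    | succ k ih => exact hnext _ ih
  refine hxf ⟨_, eq_of_forall_mem_closure_resImage hf (σ := fun k => next (L k)) fun k => ?_⟩
  rw [hL]
  exact essentialClosure_subset_closure _ (hxL k)

end EssentialClosure

section Doughnut

/-- Flip the coordinates of `y` that belong to `s`. -/
def flipOn (s : Finset ℕ) (y : ℕ → Bool) : ℕ → Bool := fun i => xor (y i) (decide (i ∈ s))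

theorem flipOn_flipOn (s : Finset ℕ) (y : ℕ → Bool) : flipOn s (flipOn s y) = y := by
  funext i
  simp [flipOn]

theorem continuous_flipOn (s : Finset ℕ) : Continuous (flipOn s) :=
  continuous_pi fun i =>
    (continuous_of_discreteTopology (f := fun b => xor b (decide (i ∈ s)))).comp
      (continuous_apply i)

/-- `flipOn s` as a homeomorphism of the Cantor space. -/
def flipOnHomeomorph (s : Finset ℕ) : (ℕ → Bool) ≃ₜ (ℕ → Bool) where
  toFun := flipOn s
  invFun := flipOn s
  left_inv := flipOn_flipOn s
  right_inv := flipOn_flipOn s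
  continuous_toFun := continuous_flipOn s
  continuous_invFun := continuous_flipOn s

theorem eventually_cylinder_subset {W : Set (ℕ → Bool)} (hW : IsOpen W) {y : ℕ → Bool}
    (hy : y ∈ W) : ∀ᶠ m in atTop, PiNat.cylinder y m ⊆ W := by
  obtain ⟨_, ⟨x, n, rfl⟩, hyx, hsub⟩ :=
    (PiNat.isTopologicalBasis_cylinders (fun _ : ℕ => Bool)).exists_subset_of_mem_open hy hW
  rw [← PiNat.mem_cylinder_iff_eq.1 hyx] at hsub
  filter_upwards [eventually_ge_atTop n] with m hm
  exact (PiNat.cylinder_anti y hm).trans hsub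

/-- If all finite modifications of `z` lie in the open set `W`, then membership in `W` is decided
by agreement with `z` on a long enough interval starting at `n`. -/
theorem exists_forall_agree_mem {W : Set (ℕ → Bool)} (hW : IsOpen W) {z : ℕ → Bool}
    (hz : ∀ s, flipOn s z ∈ W) (n : ℕ) :
    ∃ m, n ≤ m ∧ ∀ y : ℕ → Bool, (∀ i, n ≤ i → i < m → y i = z i) → y ∈ W := by
  have hev : ∀ᶠ m in atTop, ∀ s ∈ (Finset.range n).powerset,
      PiNat.cylinder (flipOn s z) m ⊆ W :=
    (Finset.eventually_all _).2 fun s _ => eventually_cylinder_subset hW (hz s)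
  obtain ⟨m, hm, hnm⟩ := (hev.and (eventually_ge_atTop n)).exists
  refine ⟨m, hnm, fun y hy => ?_⟩
  refine hm ((Finset.range n).filter fun i => y i ≠ z i)
    (Finset.mem_powerset.2 (Finset.filter_subset _ _)) fun i hi => ?_
  by_cases hin : i < n
  · cases hyi : y i <;> cases hzi : z i <;> simp [flipOn, hin, hyi, hzi]
  · simp [flipOn, hin, hy i (not_lt.1 hin) hi]

/-- If `G` is comeagre in a nonempty open set, there are a point `z` and an infinite set `F` of
coordinates such that all points agreeing with `z` off `F` are in `G`. -/
theorem exists_infinite_forall_agree_mem {U G : Set (ℕ → Bool)} (hU : IsOpen U)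
    (hne : U.Nonempty) (hG : IsMeagre (U \ G)) :
    ∃ (z : ℕ → Bool) (F : Set ℕ), F.Infinite ∧
      ∀ y : ℕ → Bool, (∀ i ∉ F, y i = z i) → y ∈ G := by
  obtain ⟨t, htG, ht, htd⟩ := mem_residual.1 hG
  obtain ⟨D, hDo, rfl⟩ := isGδ_iff_eq_iInter_nat.1 ht
  have hDd : ∀ k, Dense (D k) := fun k => htd.mono (iInter_subset D k)
  have hdense : Dense (⋂ p : ℕ × Finset ℕ, flipOnHomeomorph p.2 ⁻¹' D p.1) :=
    dense_iInter_of_isOpen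
      (fun p => (hDo p.1).preimage (flipOnHomeomorph p.2).continuous)
      (fun p => (hDd p.1).preimage (flipOnHomeomorph p.2).isOpenMap)
  obtain ⟨z, hzU, hz⟩ := hdense.inter_open_nonempty U hU hne
  have hzD : ∀ k s, flipOn s z ∈ D k := fun k s => mem_iInter.1 hz (k, s)
  choose next hle hnext using fun k n => exists_forall_agree_mem (hDo k) (hzD k) n
  obtain ⟨n₀, hn₀⟩ := (eventually_cylinder_subset hU hzU).exists
  let a : ℕ → ℕ := fun k => Nat.rec n₀ (fun k n => next k (n + 1)) k
  have ha : StrictMono a := strictMono_nat_of_lt_succ fun k => hle k (a k + 1)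
  refine ⟨z, range a, infinite_range_of_injective ha.injective, fun y hy => ?_⟩
  have hyU : y ∈ U := hn₀ fun i hi => hy i <| by
    rintro ⟨k, rfl⟩
    exact absurd (ha.monotone (Nat.zero_le k)) (not_le.2 hi)
  have hyD : y ∈ ⋂ k, D k := mem_iInter.2 fun k => hnext k (a k + 1) y fun i h1 h2 => hy i <| by
    rintro ⟨j, rfl⟩
    have hkj : k < j := ha.lt_iff_lt.1 h1
    have hjk : j < k + 1 := ha.lt_iff_lt.1 h2
    omega
  by_contra hyG
  exact htG hyD ⟨hyU, hyG⟩

end Doughnut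

theorem mem_of_chi_mem_image {T : Set (Set ℕ)} {X : Set ℕ} (h : chi X ∈ chi '' T) : X ∈ T := by
  obtain ⟨Y, hY, hYX⟩ := h
  have : Y = X := by
    ext n
    simpa [chi] using congrFun hYX n
  exact this ▸ hY

/-- The set between `A` and `A ∪ range e` coded by a point of the Cantor space. -/
def codedSet (A : Set ℕ) (e : ℕ → ℕ) (y : ℕ → Bool) : Set ℕ := A ∪ e '' {i | y i = true}

theorem apply_mem_codedSet {A : Set ℕ} {e : ℕ → ℕ} (he : e.Injective) (heA : ∀ i, e i ∉ A)
    (y : ℕ → Bool) (i : ℕ) : e i ∈ codedSet A e y ↔ y i = true := by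
  simp [codedSet, heA, he.eq_iff]

theorem continuous_chi_codedSet {A : Set ℕ} {e : ℕ → ℕ} (he : e.Injective)
    (heA : ∀ i, e i ∉ A) : Continuous fun y => chi (codedSet A e y) := by
  refine continuous_pi fun n => ?_
  by_cases hn : ∃ i, e i = n
  · obtain ⟨i, rfl⟩ := hn
    convert continuous_apply i using 2 with y
    simp [chi, apply_mem_codedSet he heA]
  · have : ∀ y, chi (codedSet A e y) n = chi A n := by
      intro y
      have : n ∈ codedSet A e y ↔ n ∈ A :=
        ⟨fun h => h.resolve_right fun ⟨i, _, hi⟩ => hn ⟨i, hi⟩, Or.inl⟩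
      simp [chi, this]
    simp only [this]
    exact continuous_const

/-- A doughnut in the Cantor space is coded to a segment. -/
theorem exists_seg_forall_codedSet {A : Set ℕ} {e : ℕ → ℕ} (he : e.Injective)
    (heA : ∀ i, e i ∉ A) (z : ℕ → Bool) {F : Set ℕ} (hF : F.Infinite) :
    ∃ C D, IsSeg C D ∧ A ⊆ C ∧ D ⊆ A ∪ range e ∧
      ∀ X ∈ Seg C D, ∃ y, (∀ i ∉ F, y i = z i) ∧ codedSet A e y = X := by
  classical
  let c : ℕ → Bool := fun i => if i ∈ F then false else z i
  let d : ℕ → Bool := fun i => if i ∈ F then true else z i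
  have hmem := apply_mem_codedSet he heA
  refine ⟨codedSet A e c, codedSet A e d, ⟨?_, ?_⟩, subset_union_left,
    union_subset_union_right A (image_subset_range _ _), ?_⟩
  · refine union_subset_union_right A (image_mono fun i hi => ?_)
    by_cases hiF : i ∈ F <;> simp_all [c, d]
  · refine (hF.image he.injOn).mono ?_
    rintro _ ⟨i, hi, rfl⟩
    simp [hmem, c, d, hi]
  · rintro X ⟨-, hCX, hXD⟩
    refine ⟨fun i => decide (e i ∈ X), fun i hi => ?_, ?_⟩
    · have h1 := @hCX (e i)
      have h2 := @hXD (e i)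
      simp only [hmem, c, d, hi, if_false] at h1 h2
      cases hz : z i <;> simp_all
    · refine Subset.antisymm ?_ fun n hn => ?_
      · rintro n (hn | ⟨i, hi, rfl⟩)
        · exact hCX (Or.inl hn)
        · simpa using hi
      · rcases hXD hn with h | ⟨i, -, rfl⟩
        · exact Or.inl h
        · exact Or.inr ⟨i, by simpa using hn, rfl⟩

theorem exists_injective_range_eq {I : Set ℕ} (hI : I.Infinite) :
    ∃ e : ℕ → ℕ, e.Injective ∧ range e = I := by
  classical
  have := hI.to_subtype
  exact ⟨Nat.orderEmbeddingOfSet I, (Nat.orderEmbeddingOfSet I).injective,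
    Nat.orderEmbeddingOfSet_range I⟩

/-- Every analytic subset of `[ω]^ω` (as a subspace of `2^ℕ`) is a v-set. -/
theorem analyticSet_isVSet (S : Set {X : Set ℕ // X.Infinite})
    (hS : @MeasureTheory.AnalyticSet _ cantorSubspaceTop S) :
    IsVSet (Subtype.val '' S) := by
  rintro A B ⟨hAB, hinf⟩
  obtain ⟨e, he, hrange⟩ := exists_injective_range_eq hinf
  have heA : ∀ i, e i ∉ A := fun i => (hrange ▸ mem_range_self i : e i ∈ B \ A).2
  have hAe : A ∪ range e = B := by rw [hrange, union_sdiff_cancel hAB]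
  have hchi : MeasureTheory.AnalyticSet (chi '' (Subtype.val '' S)) := by
    rw [image_image]
    let _ := cantorSubspaceTop
    exact hS.image_of_continuous continuous_induced_dom
  set T : Set (ℕ → Bool) := (fun y => chi (codedSet A e y)) ⁻¹' (chi '' (Subtype.val '' S))
  have : PolishSpace (ℕ → Bool) := by
    let _ := TopologicalSpace.metrizableSpaceMetric (ℕ → Bool)
    infer_instance
  have hT : MeasureTheory.AnalyticSet T := hchi.preimage (continuous_chi_codedSet he heA)
  have key : ∀ U G : Set (ℕ → Bool), IsOpen U → U.Nonempty → IsMeagre (U \ G) →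
      ∃ C D, IsSeg C D ∧ Seg C D ⊆ Seg A B ∧ ∀ X ∈ Seg C D, ∃ y ∈ G, codedSet A e y = X := by
    intro U G hU hne hG
    obtain ⟨z, F, hF, hzF⟩ := exists_infinite_forall_agree_mem hU hne hG
    obtain ⟨C, D, hCD, hAC, hDB, h⟩ := exists_seg_forall_codedSet he heA z hF
    refine ⟨C, D, hCD, fun X hX => ⟨hX.1, hAC.trans hX.2.1, hX.2.2.trans (hAe ▸ hDB)⟩,
      fun X hX => ?_⟩
    obtain ⟨y, hy, hyX⟩ := h X hX
    exact ⟨y, hzF y hy, hyX⟩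
  rcases (interior (essentialClosure T)).eq_empty_or_nonempty with hempty | hne
  · have hmeagre : IsMeagre (univ \ Tᶜ) := by
      refine ((isMeagre_diff_essentialClosure T).union (IsNowhereDense.isMeagre
        ((isClosed_essentialClosure T).isNowhereDense_iff.2 hempty))).mono ?_
      rw [sdiff_union_self, Set.sdiff_compl, univ_inter]
      exact subset_union_left
    obtain ⟨C, D, hCD, hsub, h⟩ := key univ Tᶜ isOpen_univ univ_nonempty hmeagre
    refine ⟨C, D, hCD, hsub, Or.inr (eq_empty_of_forall_notMem ?_)⟩
    rintro X ⟨hX, hXS⟩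
    obtain ⟨y, hy, rfl⟩ := h X hX
    exact hy (mem_image_of_mem chi hXS)
  · obtain ⟨C, D, hCD, hsub, h⟩ := key _ T isOpen_interior hne
      (hT.isMeagre_essentialClosure_diff.mono (sdiff_subset_sdiff_left interior_subset))
    refine ⟨C, D, hCD, hsub, Or.inl fun X hX => ?_⟩
    obtain ⟨y, hy, rfl⟩ := h X hX
    exact mem_of_chi_mem_image hy
end
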